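/- Let Φ₂ : ℂ⁴ → ℂ⁴ be a vector-valued quadratic form defined over the reals, and let C = {(x,x) = 0} be the asymptotic cone. If Φ₂(x)·conj(x) = 0 for all x ∈ C (quaternion product, conj extended ℂ-linearly), then there exists a real-linear map A : ℝ⁴ → ℝ⁴ with Φ₂(x) = A(x)·x for all x ∈ ℝ⁴. -/

import Mathlib

open Quaternion

/-- The inclusion `ℍ[ℝ] → ℍ[ℂ]` (real points of the complexification `ℂ⁴ ≅ ℍ[ℂ]`). -/
noncomputable def toQC (q : ℍ[ℝ]) : ℍ[ℂ] :=
  ⟨(q.re : ℂ), (q.imI : ℂ), (q.imJ : ℂ), (q.imK : ℂ)⟩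

/-- Purely ring-theoretic core of the computation of the polar form. -/
theorem ring_aux {R : Type*} [Ring R] [Algebra ℂ R] (f g p a b a' b' : R)
    (hb' : b' * b = 1) (hab' : a' * b = - (b' * a))
    (h : ∀ c : ℂ, c * c = -1 → (f + (c * c) • g + c • p) * (a' + c • b') = 0) :
    p = f * a' * b + g * b' * a := by
  have ex : ∀ c : ℂ, c * c = -1 → (f - g) * a' - p * b' + c • (p * a' + (f - g) * b') = 0 := by
    intro c hc
    have h := h c hc
    have e : c • p * c • b' = - (p * b') := by
      rw [smul_mul_smul_comm, hc, neg_one_smul]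
    rw [hc, mul_add, add_mul _ (c • p) (c • b'), e, add_mul, mul_smul_comm, smul_mul_assoc,
      neg_one_smul, ← sub_eq_add_neg] at h
    rw [← h, smul_add]
    abel
  have h1 := ex Complex.I Complex.I_mul_I
  have h2 := ex (-Complex.I) (by simp)
  have h3 : (f - g) * a' - p * b' = 0 := by
    rw [neg_smul] at h2
    have h4 : (2 : ℂ) • ((f - g) * a' - p * b') = 0 := by
      rw [two_smul]
      have := congrArg₂ (· + ·) h1 h2
      simp only [add_zero] at this
      rw [← this]; abel
    exact (smul_eq_zero.mp h4).resolve_left two_ne_zero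
  have h5 : p = (f - g) * a' * b := by
    rw [sub_eq_zero.mp h3, mul_assoc, hb', mul_one]
  rw [h5, sub_mul, sub_mul, mul_assoc g, mul_assoc g, hab']
  simp

/-- On an orthonormal pair the polar form is determined by the diagonal values. -/
theorem polar_aux (Φ : QuadraticMap ℂ ℍ[ℂ] ℍ[ℂ])
    (hcone : ∀ x : ℍ[ℂ], (x * star x).re = 0 → Φ x * star x = 0) (a b : ℍ[ℂ])
    (ha : (a * star a).re = 1) (hb : (b * star b).re = 1) (hb' : star b * b = 1)
    (hab : (a * star b + b * star a).re = 0) (hab' : star a * b = - (star b * a)) :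
    QuadraticMap.polar Φ a b = Φ a * star a * b + Φ b * star b * a := by
  refine ring_aux (Φ a) (Φ b) _ a b (star a) (star b) hb' hab' ?_
  intro c hc
  have hs : star (a + c • b) = star a + c • star b := by ext <;> simp <;> ring
  have hn : ((a + c • b) * star (a + c • b)).re = 0 := by
    simp at ha hb hab ⊢
    linear_combination ha + c * hab + c * c * hb + hc
  have h := hcone _ hn
  have e : Φ (a + c • b) = Φ a + (c * c) • Φ b + c • QuadraticMap.polar Φ a b := by
    have e1 := QuadraticMap.map_add (⇑Φ) a (c • b)
    have e2 := QuadraticMap.map_smul Φ c b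
    have e3 := QuadraticMap.polar_smul_right Φ c a b
    exact e1.trans (congrArg₂ (fun u v => Φ a + u + v) e2 e3)
  rw [hs, e] at h
  exact h

/-- Expansion of a quadratic map on a combination of four vectors. -/
theorem expand_aux {M N : Type*} [AddCommGroup M] [Module ℂ M] [AddCommGroup N] [Module ℂ N]
    (Φ : QuadraticMap ℂ M N) (c0 c1 c2 c3 : ℂ) (e0 e1 e2 e3 : M) :
    Φ (c0 • e0 + c1 • e1 + c2 • e2 + c3 • e3) =
      (c0 * c0) • Φ e0 + (c1 * c1) • Φ e1 + (c2 * c2) • Φ e2 + (c3 * c3) • Φ e3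
      + (c0 * c1) • QuadraticMap.polar Φ e0 e1 + (c0 * c2) • QuadraticMap.polar Φ e0 e2
      + (c0 * c3) • QuadraticMap.polar Φ e0 e3 + (c1 * c2) • QuadraticMap.polar Φ e1 e2
      + (c1 * c3) • QuadraticMap.polar Φ e1 e3 + (c2 * c3) • QuadraticMap.polar Φ e2 e3 := by
  rw [QuadraticMap.map_add (⇑Φ), QuadraticMap.map_add (⇑Φ), QuadraticMap.map_add (⇑Φ)]
  simp only [QuadraticMap.map_smul, QuadraticMap.polar_add_left,
      QuadraticMap.polar_smul_left, QuadraticMap.polar_smul_right]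
  module

theorem prod_aux {R : Type*} [Ring R] [Algebra ℂ R] (c0 c1 c2 c3 : ℂ)
    (f0 f1 f2 f3 s0 s1 s2 s3 e0 e1 e2 e3 : R)
    (h0 : s0 * e0 = 1) (h1 : s1 * e1 = 1) (h2 : s2 * e2 = 1) (h3 : s3 * e3 = 1) :
    (c0 * c0) • f0 + (c1 * c1) • f1 + (c2 * c2) • f2 + (c3 * c3) • f3
      + (c0 * c1) • (f0 * s0 * e1 + f1 * s1 * e0) + (c0 * c2) • (f0 * s0 * e2 + f2 * s2 * e0)
      + (c0 * c3) • (f0 * s0 * e3 + f3 * s3 * e0) + (c1 * c2) • (f1 * s1 * e2 + f2 * s2 * e1)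
      + (c1 * c3) • (f1 * s1 * e3 + f3 * s3 * e1) + (c2 * c3) • (f2 * s2 * e3 + f3 * s3 * e2)
    = (c0 • (f0 * s0) + c1 • (f1 * s1) + c2 • (f2 * s2) + c3 • (f3 * s3))
      * (c0 • e0 + c1 • e1 + c2 • e2 + c3 • e3) := by
  simp only [add_mul, mul_add, smul_mul_smul_comm, mul_assoc, h0, h1, h2, h3, mul_one]
  module

theorem toQC_mul (p q : ℍ[ℝ]) : toQC (p * q) = toQC p * toQC q := by
  ext <;> simp <;> simp [toQC]

theorem toQC_add (p q : ℍ[ℝ]) : toQC (p + q) = toQC p + toQC q := by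
  ext <;> simp <;> simp [toQC]

theorem toQC_star (p : ℍ[ℝ]) : toQC (star p) = star (toQC p) := by
  ext <;> simp <;> simp [toQC]

theorem toQC_smul (c : ℝ) (p : ℍ[ℝ]) : toQC (c • p) = (c : ℂ) • toQC p := by
  ext <;> simp <;> simp [toQC]

/-- A real quaternion from its coordinates. -/
def mkQ (a b c d : ℝ) : ℍ[ℝ] := ⟨a, b, c, d⟩

/-- Let `Φ₂ : ℂ⁴ → ℂ⁴` (with `ℂ⁴ ≅ ℍ[ℂ]`) be a vector-valued quadratic form defined
over the reals such that `Φ₂(x)·conj(x) = 0` (quaternion product, conjugation extended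
ℂ-linearly) for every `x` in the asymptotic cone `{x : (x,x) = (x·conj x).re = 0}`.
Then there is a real-linear map `A : ℝ⁴ → ℝ⁴` with `Φ₂(x) = A(x)·x` on `ℝ⁴`. -/
theorem stmt18 (Φ₂ : QuadraticMap ℂ ℍ[ℂ] ℍ[ℂ])
    (hreal : ∀ q : ℍ[ℝ], ∃ r : ℍ[ℝ], Φ₂ (toQC q) = toQC r)
    (hcone : ∀ x : ℍ[ℂ], (x * star x).re = 0 → Φ₂ x * star x = 0) :
    ∃ A : ℍ[ℝ] →ₗ[ℝ] ℍ[ℝ], ∀ q : ℍ[ℝ], Φ₂ (toQC q) = toQC (A q * q) := by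
  obtain ⟨r0, h0⟩ := hreal (mkQ 1 0 0 0)
  obtain ⟨r1, h1⟩ := hreal (mkQ 0 1 0 0)
  obtain ⟨r2, h2⟩ := hreal (mkQ 0 0 1 0)
  obtain ⟨r3, h3⟩ := hreal (mkQ 0 0 0 1)
  have p01 := polar_aux Φ₂ hcone (toQC (mkQ 1 0 0 0)) (toQC (mkQ 0 1 0 0))
    (by simp <;> simp [toQC, mkQ])
    (by simp <;> simp [toQC, mkQ])
    (by ext <;> simp <;> simp [toQC, mkQ])
    (by simp <;> simp [toQC, mkQ])
    (by ext <;> simp <;> simp [toQC, mkQ])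
  have p02 := polar_aux Φ₂ hcone (toQC (mkQ 1 0 0 0)) (toQC (mkQ 0 0 1 0))
    (by simp <;> simp [toQC, mkQ])
    (by simp <;> simp [toQC, mkQ])
    (by ext <;> simp <;> simp [toQC, mkQ])
    (by simp <;> simp [toQC, mkQ])
    (by ext <;> simp <;> simp [toQC, mkQ])
  have p03 := polar_aux Φ₂ hcone (toQC (mkQ 1 0 0 0)) (toQC (mkQ 0 0 0 1))
    (by simp <;> simp [toQC, mkQ])
    (by simp <;> simp [toQC, mkQ])
    (by ext <;> simp <;> simp [toQC, mkQ])
    (by simp <;> simp [toQC, mkQ])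
    (by ext <;> simp <;> simp [toQC, mkQ])
  have p12 := polar_aux Φ₂ hcone (toQC (mkQ 0 1 0 0)) (toQC (mkQ 0 0 1 0))
    (by simp <;> simp [toQC, mkQ])
    (by simp <;> simp [toQC, mkQ])
    (by ext <;> simp <;> simp [toQC, mkQ])
    (by simp <;> simp [toQC, mkQ])
    (by ext <;> simp <;> simp [toQC, mkQ])
  have p13 := polar_aux Φ₂ hcone (toQC (mkQ 0 1 0 0)) (toQC (mkQ 0 0 0 1))
    (by simp <;> simp [toQC, mkQ])
    (by simp <;> simp [toQC, mkQ])
    (by ext <;> simp <;> simp [toQC, mkQ])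
    (by simp <;> simp [toQC, mkQ])
    (by ext <;> simp <;> simp [toQC, mkQ])
  have p23 := polar_aux Φ₂ hcone (toQC (mkQ 0 0 1 0)) (toQC (mkQ 0 0 0 1))
    (by simp <;> simp [toQC, mkQ])
    (by simp <;> simp [toQC, mkQ])
    (by ext <;> simp <;> simp [toQC, mkQ])
    (by simp <;> simp [toQC, mkQ])
    (by ext <;> simp <;> simp [toQC, mkQ])
  refine ⟨{ toFun := fun q => q.re • (r0 * star (mkQ 1 0 0 0)) + q.imI • (r1 * star (mkQ 0 1 0 0))
              + q.imJ • (r2 * star (mkQ 0 0 1 0)) + q.imK • (r3 * star (mkQ 0 0 0 1))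
            map_add' := ?_
            map_smul' := ?_ }, ?_⟩
  · intro x y
    simp only [re_add, imI_add, imJ_add, imK_add, add_smul]
    abel
  · intro c x
    simp only [re_smul, imI_smul, imJ_smul, imK_smul, smul_eq_mul, mul_smul, smul_add,
      RingHom.id_apply]
  · intro q
    have hq : toQC q = (q.re : ℂ) • toQC (mkQ 1 0 0 0) + (q.imI : ℂ) • toQC (mkQ 0 1 0 0)
        + (q.imJ : ℂ) • toQC (mkQ 0 0 1 0) + (q.imK : ℂ) • toQC (mkQ 0 0 0 1) := by
      ext <;> simp <;> simp [toQC, mkQ]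
    rw [hq, expand_aux, p01, p02, p03, p12, p13, p23, h0, h1, h2, h3]
    rw [LinearMap.coe_mk, AddHom.coe_mk, toQC_mul, toQC_add, toQC_add, toQC_add, toQC_smul,
      toQC_smul, toQC_smul, toQC_smul, toQC_mul, toQC_mul, toQC_mul, toQC_mul,
      toQC_star, toQC_star, toQC_star, toQC_star, hq]
    exact prod_aux _ _ _ _ _ _ _ _ _ _ _ _ _ _ _ _
      (by ext <;> simp <;> simp [toQC, mkQ]) (by ext <;> simp <;> simp [toQC, mkQ])
      (by ext <;> simp <;> simp [toQC, mkQ]) (by ext <;> simp <;> simp [toQC, mkQ])
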